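/- Let d⁽¹⁾, d⁽²⁾ ∈ ℝ³ be fixed vectors, let f₁, f₂ : ℝ → ℝ be scalar controls, and let x : ℝ → ℝ³ be differentiable with x'(t) = f₁(t) • d⁽¹⁾ + f₂(t) • d⁽²⁾ for all t. Then the determinant u(t) = det[x(t), d⁽¹⁾, d⁽²⁾] (of the 3×3 matrix with these columns) is constant in t. Consequently, if det[x(0), d⁽¹⁾, d⁽²⁾] ≠ 0, then x(t) ≠ 0 for all t, so no choice of the two controls can drive the state to the origin. -/

import Mathlib

/-- For the three-dimensional driftless two-input system
`x' = f₁ t • d¹ + f₂ t • d²`, the determinant of the 3×3 matrix with columns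
`x t`, `d¹`, `d²` is constant in time; consequently, if it is nonzero at the
initial time, the state can never reach the origin. -/
theorem det_invariant_and_origin_unreachable
    (d₁ d₂ : Fin 3 → ℝ) (f₁ f₂ : ℝ → ℝ) (x : ℝ → Fin 3 → ℝ)
    (hx : ∀ t, HasDerivAt x (f₁ t • d₁ + f₂ t • d₂) t) :
    (∀ t, ((Matrix.of ![x t, d₁, d₂]).transpose).det =
          ((Matrix.of ![x 0, d₁, d₂]).transpose).det) ∧
    (((Matrix.of ![x 0, d₁, d₂]).transpose).det ≠ 0 → ∀ t, x t ≠ 0) := by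
  have hdet : ∀ t, ((Matrix.of ![x t, d₁, d₂]).transpose).det =
      ((Matrix.of ![x 0, d₁, d₂]).transpose).det := by
    have hderiv : ∀ t, HasDerivAt
        (fun s => ((Matrix.of ![x s, d₁, d₂]).transpose).det) 0 t := by
      intro t
      have hcoord := hasDerivAt_pi.1 (hx t)
      have hcofactor := (((hcoord 0).mul_const (d₁ 1 * d₂ 2 - d₁ 2 * d₂ 1)).add
        ((hcoord 1).mul_const (d₁ 2 * d₂ 0 - d₁ 0 * d₂ 2))).add
        ((hcoord 2).mul_const (d₁ 0 * d₂ 1 - d₁ 1 * d₂ 0))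
      have hexpand : (fun s => ((Matrix.of ![x s, d₁, d₂]).transpose).det) =
          ((fun s => x s 0 * (d₁ 1 * d₂ 2 - d₁ 2 * d₂ 1)) +
            fun s => x s 1 * (d₁ 2 * d₂ 0 - d₁ 0 * d₂ 2)) +
            fun s => x s 2 * (d₁ 0 * d₂ 1 - d₁ 1 * d₂ 0) := by
        funext s
        simp [Matrix.det_fin_three]
        ring
      rw [hexpand]
      refine hcofactor.congr_deriv ?_
      simp only [Pi.add_apply, Pi.smul_apply, smul_eq_mul]
      ring
    intro t
    exact is_const_of_deriv_eq_zero (fun s => (hderiv s).differentiableAt)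
      (fun s => (hderiv s).deriv) t 0
  refine ⟨hdet, fun h t ht => h ?_⟩
  rw [← hdet t, ht]
  simp [Matrix.det_fin_three]
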